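/- arXiv:0805.1391 — 2 statements merged into one kernel-verified Lean document; each statement's English description precedes it below -/
import Mathlib

section
/- For every game graph G = ((S,E),(S₁,S₂)) and every priority function p : S → {0,…,d−1}, player 2 has a single memoryless strategy π : S₂ → S (with π(s) ∈ E(s) for all s ∈ S₂) that is winning for the objective WeakParityOdd(p) from every state of the winning set W₂^G(WeakParityOdd(p)); that is, for every s ∈ W₂^G(WeakParityOdd(p)) and every player-1 strategy σ, the play ω(s,σ,π) ∈ WeakParityOdd(p). -/
open scoped Classical

/-! Framework for two-player games on graphs.

A game graph on a state type `S` is given by an edge relation `E : S → S → Prop`,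
the set `S1 : Set S` of player-1 states (player-2 states are `S1ᶜ`), together with
the assumption that every state has a successor.  To deal uniformly with sub-games,
all notions are relativized to a carrier set `C : Set S` of states (the full game
corresponds to `C = Set.univ`). -/

/-- A (history-dependent) strategy for player 1 in the game with carrier `C`:
given the history `w` (the play so far, excluding the current state) and the
current state `s` (a player-1 state of the game), it chooses a successor of `s`
inside the game. -/
def Strategy1 {S : Type} (C : Set S) (E : S → S → Prop) (S1 : Set S)
    (σ : List S → S → S) : Prop :=
  ∀ w s, s ∈ C → s ∈ S1 → E s (σ w s) ∧ σ w s ∈ C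

/-- A (history-dependent) strategy for player 2 in the game with carrier `C`. -/
def Strategy2 {S : Type} (C : Set S) (E : S → S → Prop) (S1 : Set S)
    (π : List S → S → S) : Prop :=
  ∀ w s, s ∈ C → s ∉ S1 → E s (π w s) ∧ π w s ∈ C

/-- Auxiliary function: the pair (history, current state) after `n` steps of the
play from `s` in which player 1 follows `σ` and player 2 follows `π`. -/
noncomputable def playAux {S : Type} (S1 : Set S) (σ π : List S → S → S) (s : S) :
    ℕ → List S × S
  | 0 => ([], s)
  | n + 1 =>
      let prev := playAux S1 σ π s n
      (prev.1 ++ [prev.2],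
        if prev.2 ∈ S1 then σ prev.1 prev.2 else π prev.1 prev.2)

/-- The unique play `ω(s, σ, π)` starting from `s` in which player 1 follows `σ`
and player 2 follows `π`. -/
noncomputable def play {S : Type} (S1 : Set S) (σ π : List S → S → S) (s : S)
    (n : ℕ) : S :=
  (playAux S1 σ π s n).2

/-- The winning set of player 1 for the objective `Φ` in the game with carrier `C`. -/
def W1 {S : Type} (C : Set S) (E : S → S → Prop) (S1 : Set S)
    (Φ : Set (ℕ → S)) : Set S :=
  {s | s ∈ C ∧ ∃ σ, Strategy1 C E S1 σ ∧
        ∀ π, Strategy2 C E S1 π → play S1 σ π s ∈ Φ}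

/-- The winning set of player 2 for the objective `Ψ` in the game with carrier `C`. -/
def W2 {S : Type} (C : Set S) (E : S → S → Prop) (S1 : Set S)
    (Ψ : Set (ℕ → S)) : Set S :=
  {s | s ∈ C ∧ ∃ π, Strategy2 C E S1 π ∧
        ∀ σ, Strategy1 C E S1 σ → play S1 σ π s ∈ Ψ}

/-- The reachability objective: some state of `T` is visited. -/
def Reach {S : Type} (T : Set S) : Set (ℕ → S) := {ω | ∃ k, ω k ∈ T}

/-- The safety objective: only states of `F` are visited. -/
def Safe {S : Type} (F : Set S) : Set (ℕ → S) := {ω | ∀ k, ω k ∈ F}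

/-- The weak-parity objective for player 1: the minimal priority occurring in the
play is even. -/
def WeakParityEven {S : Type} (p : S → ℕ) : Set (ℕ → S) :=
  {ω | Even (sInf (p '' Set.range ω))}

/-- The weak-parity objective for player 2: the minimal priority occurring in the
play is odd. -/
def WeakParityOdd {S : Type} (p : S → ℕ) : Set (ℕ → S) :=
  {ω | Odd (sInf (p '' Set.range ω))}

/-- The player-1 attractor of `U` in the game with carrier `C`. -/
def Attr1 {S : Type} (C : Set S) (E : S → S → Prop) (S1 : Set S) (U : Set S) :
    Set S :=
  W1 C E S1 (Reach U)

/-- The player-2 attractor of `U` in the game with carrier `C`. -/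
def Attr2 {S : Type} (C : Set S) (E : S → S → Prop) (S1 : Set S) (U : Set S) :
    Set S :=
  W2 C E S1 (Reach U)

/-- Attractor with ranks inside a carrier `C`, for the player owning the states in `P`. -/
theorem attractor_exists {S : Type} [Fintype S] (E : S → S → Prop) (P C T : Set S)
    (hC : ∀ s ∈ C, ∃ t ∈ C, E s t) (hT : T ⊆ C) :
    ∃ (A : Set S) (rk : S → ℕ), T ⊆ A ∧ A ⊆ C ∧
      (∀ s ∈ C, s ∈ P → (∃ t ∈ A, E s t) → s ∈ A) ∧
      (∀ s ∈ C, s ∉ P → (∀ t ∈ C, E s t → t ∈ A) → s ∈ A) ∧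
      (∀ s ∈ A, s ∈ P → s ∈ T ∨ ∃ t ∈ A, E s t ∧ rk t < rk s) ∧
      (∀ s ∈ A, s ∉ P → s ∈ T ∨ ∀ t ∈ C, E s t → t ∈ A ∧ rk t < rk s) := by
  let B : ℕ → Set S := fun n => Nat.rec T (fun _ X => X ∪ {s | s ∈ C ∧
    (s ∈ P → ∃ t ∈ X, E s t) ∧ (s ∉ P → ∀ t ∈ C, E s t → t ∈ X)}) n
  have hB0 : B 0 = T := rfl
  have hBs : ∀ n, B (n+1) = B n ∪ {s | s ∈ C ∧
    (s ∈ P → ∃ t ∈ B n, E s t) ∧ (s ∉ P → ∀ t ∈ C, E s t → t ∈ B n)} := fun n => rfl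
  clear_value B
  have hmono : Monotone B := monotone_nat_of_le_succ (fun n => by
    rw [hBs]; exact Set.subset_union_left)
  have hBC : ∀ n, B n ⊆ C := by
    intro n
    induction n with
    | zero => rw [hB0]; exact hT
    | succ n ih =>
      rw [hBs]
      rintro s (h | h)
      · exact ih h
      · exact h.1
  let rk : S → ℕ := fun s => if h : ∃ n, s ∈ B n then Nat.find h else 0
  have hrk : ∀ s n, s ∈ B n → s ∈ B (rk s) ∧ rk s ≤ n := by
    intro s n h
    have hh : ∃ n, s ∈ B n := ⟨n, h⟩
    have : rk s = Nat.find hh := dif_pos hh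
    rw [this]
    exact ⟨Nat.find_spec hh, Nat.find_min' hh h⟩
  clear_value rk
  have key : ∀ s n, s ∈ B n → s ∈ T ∨ ∃ m, m < rk s ∧ 
      (s ∈ P → ∃ t ∈ B m, E s t) ∧ (s ∉ P → ∀ t ∈ C, E s t → t ∈ B m) := by
    intro s n h
    have h1 := (hrk s n h).1
    rcases hr : rk s with _ | m
    · left; rw [hr, hB0] at h1; exact h1
    · rw [hr, hBs] at h1
      rcases h1 with h1 | h1
      · have := (hrk s m h1).2; omega
      · exact Or.inr ⟨m, by omega, h1.2⟩
  refine ⟨{s | ∃ n, s ∈ B n}, rk, ?_, ?_, ?_, ?_, ?_, ?_⟩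
  · intro s hs; exact ⟨0, hB0 ▸ hs⟩
  · rintro s ⟨n, hn⟩; exact hBC n hn
  · rintro s hs hP ⟨t, ⟨n, hn⟩, hE⟩
    refine ⟨n+1, ?_⟩
    rw [hBs]
    exact Or.inr ⟨hs, fun _ => ⟨t, hn, hE⟩, fun h => absurd hP h⟩
  · intro s hs hP h
    refine ⟨Finset.univ.sup rk + 1, ?_⟩
    rw [hBs]
    refine Or.inr ⟨hs, fun h => absurd h hP, fun _ t ht hE => ?_⟩
    obtain ⟨n, hn⟩ := h t ht hE
    exact hmono (Finset.le_sup (Finset.mem_univ t)) (hrk t n hn).1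
  · rintro s ⟨n, hn⟩ hP
    rcases key s n hn with h | ⟨m, hm, h, -⟩
    · exact Or.inl h
    · obtain ⟨t, ht, hE⟩ := h hP
      exact Or.inr ⟨t, ⟨m, ht⟩, hE, lt_of_le_of_lt (hrk t m ht).2 hm⟩
  · rintro s ⟨n, hn⟩ hP
    rcases key s n hn with h | ⟨m, hm, -, h⟩
    · exact Or.inl h
    · exact Or.inr fun t ht hE => ⟨⟨m, h hP t ht hE⟩, lt_of_le_of_lt (hrk t m (h hP t ht hE)).2 hm⟩

/-- The layered decomposition of a weak parity (sub-)game. -/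
theorem layers_exist {S : Type} [Fintype S] (E : S → S → Prop) (S1 : Set S) (p : S → ℕ) :
    ∀ (n k : ℕ) (C : Set S), (∀ s ∈ C, ∃ t ∈ C, E s t) → (∀ s ∈ C, k ≤ p s ∧ p s < k + n) →
    ∃ idx rk : S → ℕ,
      (∀ s ∈ C, k ≤ idx s ∧ idx s ≤ p s) ∧
      (∀ s ∈ C, ∀ t ∈ C, E s t → idx t < idx s → ¬ (Even (idx t) ↔ s ∈ S1)) ∧
      (∀ s ∈ C, ∃ t ∈ C, E s t ∧ idx s ≤ idx t) ∧
      (∀ s ∈ C, (Even (idx s) ↔ s ∈ S1) → p s = idx s ∨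
        ∃ t ∈ C, E s t ∧ idx t = idx s ∧ rk t < rk s) ∧
      (∀ s ∈ C, ¬ (Even (idx s) ↔ s ∈ S1) → p s = idx s ∨
        ∀ t ∈ C, E s t → idx s ≤ idx t → idx t = idx s ∧ rk t < rk s) := by
  intro n
  induction n with
  | zero =>
    intro k C _ hp
    have hC : ∀ s, s ∉ C := fun s hs => by have := hp s hs; omega
    exact ⟨fun _ => 0, fun _ => 0, fun s hs => absurd hs (hC s), fun s hs => absurd hs (hC s),
      fun s hs => absurd hs (hC s), fun s hs => absurd hs (hC s), fun s hs => absurd hs (hC s)⟩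
  | succ n ih =>
    intro k C hC hp
    obtain ⟨A, rkA, hTA, hAC, hcl1, hcl2, hr1, hr2⟩ :=
      attractor_exists E {s | Even k ↔ s ∈ S1} C {s | s ∈ C ∧ p s = k} hC (fun s hs => hs.1)
    simp only [Set.mem_ofPred_eq] at hcl1 hcl2 hr1 hr2
    have hC' : ∀ s ∈ C \ A, ∃ t ∈ C \ A, E s t := by
      rintro s ⟨hs, hsA⟩
      by_cases ho : Even k ↔ s ∈ S1
      · obtain ⟨t, ht, hE⟩ := hC s hs
        exact ⟨t, ⟨ht, fun htA => hsA (hcl1 s hs ho ⟨t, htA, hE⟩)⟩, hE⟩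
      · by_contra hcon
        refine hsA (hcl2 s hs ho fun t ht hE => ?_)
        by_contra htA
        exact hcon ⟨t, ⟨ht, htA⟩, hE⟩
    obtain ⟨idx, rk, h1, h2, h3, h4, h5⟩ := ih (k+1) (C \ A) hC' (by
      rintro s ⟨hs, hsA⟩
      have := hp s hs
      have : p s ≠ k := fun h => hsA (hTA ⟨hs, h⟩)
      omega)
    refine ⟨fun s => if s ∈ A then k else idx s, fun s => if s ∈ A then rkA s else rk s,
      ?_, ?_, ?_, ?_, ?_⟩
    · intro s hs
      by_cases hA : s ∈ A
      · simp only [hA, if_true]; exact ⟨le_rfl, (hp s hs).1⟩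
      · simp only [hA, if_false]; have := h1 s ⟨hs, hA⟩; omega
    · intro s hs t ht hE hlt ho
      by_cases hA : s ∈ A
      · by_cases hB : t ∈ A
        · simp [hA, hB] at hlt
        · simp only [hA, hB, if_true, if_false] at hlt; have := h1 t ⟨ht, hB⟩; omega
      · by_cases hB : t ∈ A
        · simp only [hB, if_true] at ho
          exact hA (hcl1 s hs ho ⟨t, hB, hE⟩)
        · simp only [hA, hB, if_false] at hlt ho
          exact h2 s ⟨hs, hA⟩ t ⟨ht, hB⟩ hE hlt ho
    · intro s hs
      by_cases hA : s ∈ A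
      · obtain ⟨t, ht, hE⟩ := hC s hs
        refine ⟨t, ht, hE, ?_⟩
        by_cases hB : t ∈ A
        · simp [hA, hB]
        · simp only [hA, hB, if_true, if_false]; have := h1 t ⟨ht, hB⟩; omega
      · obtain ⟨t, ht, hE, hle⟩ := h3 s ⟨hs, hA⟩
        refine ⟨t, ht.1, hE, ?_⟩
        simpa only [hA, ht.2, if_false] using hle
    · intro s hs ho
      by_cases hA : s ∈ A
      · simp only [hA, if_true] at ho ⊢
        rcases hr1 s hA ho with h | ⟨t, ht, hE, hlt⟩
        · exact Or.inl h.2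
        · refine Or.inr ⟨t, hAC ht, hE, ?_⟩
          simpa [ht] using hlt
      · simp only [hA, if_false] at ho ⊢
        rcases h4 s ⟨hs, hA⟩ ho with h | ⟨t, ht, hE, hlt⟩
        · exact Or.inl h
        · refine Or.inr ⟨t, ht.1, hE, ?_⟩
          simpa only [ht.2, if_false] using hlt
    · intro s hs ho
      by_cases hA : s ∈ A
      · simp only [hA, if_true] at ho ⊢
        rcases hr2 s hA ho with h | h
        · exact Or.inl h.2
        · refine Or.inr fun t ht hE _ => ?_
          have := h t ht hE
          simpa [this.1] using this.2
      · simp only [hA, if_false] at ho ⊢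
        rcases h5 s ⟨hs, hA⟩ ho with h | h
        · exact Or.inl h
        · refine Or.inr fun t ht hE hle => ?_
          by_cases hB : t ∈ A
          · simp only [hB, if_true] at hle
            have := h1 s ⟨hs, hA⟩; omega
          · simp only [hB, if_false] at hle ⊢
            exact h t ⟨ht, hB⟩ hE hle

/-- A single positional choice that wins, for both players, from the respective regions. -/
theorem positional_exists {S : Type} [Fintype S]
    (E : S → S → Prop) (S1 : Set S) (hE : ∀ s, ∃ t, E s t)
    (d : ℕ) (p : S → ℕ) (hp : ∀ s, p s < d) :
    ∃ (idx : S → ℕ) (f : S → S), (∀ s, E s (f s)) ∧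
      ∀ (b : Prop) (ω : ℕ → S), (∀ n, E (ω n) (ω (n+1))) →
        (∀ n, (b ↔ ω n ∈ S1) → ω (n+1) = f (ω n)) → (Even (idx (ω 0)) ↔ b) →
        (Even (sInf (p '' Set.range ω)) ↔ b) := by
  obtain ⟨idx, rk, h1, h2, h3, h4, h5⟩ := layers_exist E S1 p d 0 Set.univ
    (fun s _ => by simpa using hE s) (fun s _ => ⟨Nat.zero_le _, by simpa using hp s⟩)
  simp only [Set.mem_univ, true_and, forall_const] at h1 h2 h3 h4 h5
  have hf : ∀ s, ∃ t, E s t ∧ idx s ≤ idx t ∧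
      ((Even (idx s) ↔ s ∈ S1) → p s ≠ idx s → idx t = idx s ∧ rk t < rk s) := by
    intro s
    by_cases h : (Even (idx s) ↔ s ∈ S1) ∧ p s ≠ idx s
    · rcases h4 s h.1 with h' | ⟨t, hE, he, hr⟩
      · exact absurd h' h.2
      · exact ⟨t, hE, he.ge, fun _ _ => ⟨he, hr⟩⟩
    · obtain ⟨t, hE, hle⟩ := h3 s
      exact ⟨t, hE, hle, fun a b => absurd ⟨a, b⟩ h⟩
  choose f hf1 hf2 hf3 using hf
  refine ⟨idx, f, hf1, ?_⟩
  intro b ω hω hωf h0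
  have hex : ∃ m, ∃ n, idx (ω n) = m := ⟨_, 0, rfl⟩
  obtain ⟨m, hm, hmin⟩ : ∃ m, (∃ n, idx (ω n) = m) ∧ ∀ n, m ≤ idx (ω n) :=
    ⟨Nat.find hex, Nat.find_spec hex, fun n => Nat.find_min' hex ⟨n, rfl⟩⟩
  have hmb : Even m ↔ b := by
    have hN := Nat.find_spec hm
    have hNmin := fun j (hj : j < Nat.find hm) => Nat.find_min hm hj
    rcases hNe : Nat.find hm with _ | N
    · rw [hNe] at hN; rw [← hN]; exact h0
    · rw [hNe] at hN
      have hne := hNmin N (by omega)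
      have hlt : idx (ω (N+1)) < idx (ω N) := by have := hmin N; omega
      have hno : ¬ (b ↔ ω N ∈ S1) := by
        intro hb
        have := hωf N hb
        have := hf2 (ω N)
        rw [← hωf N hb] at this
        omega
      have h := h2 _ _ (hω N) hlt
      rw [hN] at h
      tauto
  have hreach : ∀ r n, idx (ω n) = m → rk (ω n) = r → ∃ n', p (ω n') = m := by
    intro r
    induction r using Nat.strong_induction_on with
    | _ r ih =>
      intro n hn hr
      by_cases hpm : p (ω n) = m
      · exact ⟨n, hpm⟩
      have hstep : idx (ω (n+1)) = idx (ω n) ∧ rk (ω (n+1)) < rk (ω n) := by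
        by_cases ho : b ↔ ω n ∈ S1
        · rw [hωf n ho]
          exact hf3 (ω n) (by rw [hn]; tauto) (by rw [hn]; exact hpm)
        · rcases h5 (ω n) (by rw [hn]; tauto) with h | h
          · exact absurd (h.trans hn) hpm
          · exact h _ (hω n) (by rw [hn]; exact hmin _)
      exact ih _ (hr ▸ hstep.2) (n+1) (hstep.1.trans hn) rfl
  obtain ⟨n, hn⟩ := hm
  obtain ⟨n', hn'⟩ := hreach _ n hn rfl
  have : sInf (p '' Set.range ω) = m := by
    apply le_antisymm
    · exact Nat.sInf_le ⟨ω n', ⟨n', rfl⟩, hn'⟩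
    · refine le_csInf ⟨_, ω n', ⟨n', rfl⟩, hn'⟩ ?_
      rintro _ ⟨_, ⟨j, rfl⟩, rfl⟩
      exact (hmin j).trans (h1 _).2
  rw [this]; exact hmb

theorem play_succ {S : Type} (S1 : Set S) (σ π : List S → S → S) (s : S) (n : ℕ) :
    play S1 σ π s (n+1) = if play S1 σ π s n ∈ S1
      then σ (playAux S1 σ π s n).1 (play S1 σ π s n)
      else π (playAux S1 σ π s n).1 (play S1 σ π s n) := rfl

theorem play_edge {S : Type} (E : S → S → Prop) (S1 : Set S) (σ π : List S → S → S) (s : S)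
    (hσ : Strategy1 Set.univ E S1 σ) (hπ : Strategy2 Set.univ E S1 π) (n : ℕ) :
    E (play S1 σ π s n) (play S1 σ π s (n+1)) := by
  rw [play_succ]
  split_ifs with h
  · exact (hσ _ _ trivial h).1
  · exact (hπ _ _ trivial h).1

/-- Player 2 has a single memoryless strategy `π : S₂ → S`
(with `π(s) ∈ E(s)` for all `s ∈ S₂`) that is winning for `WeakParityOdd(p)`
from every state of the winning set `W₂ᴳ(WeakParityOdd(p))`. -/
theorem weak_parity_memoryless_player_two {S : Type} [Fintype S]
    (E : S → S → Prop) (S1 : Set S) (hE : ∀ s, ∃ t, E s t)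
    (d : ℕ) (p : S → ℕ) (hp : ∀ s, p s < d) :
    ∃ πm : S → S, (∀ s ∉ S1, E s (πm s)) ∧
      ∀ s ∈ W2 Set.univ E S1 (WeakParityOdd p),
        ∀ σ, Strategy1 Set.univ E S1 σ →
          play S1 σ (fun _ t => πm t) s ∈ WeakParityOdd p := by
  obtain ⟨idx, f, hf, key⟩ := positional_exists E S1 hE d p hp
  refine ⟨f, fun s _ => hf s, ?_⟩
  rintro s ⟨-, π, hπ, hwin⟩ σ hσ
  have hodd : ¬ Even (idx s) := by
    intro hev
    have hs1 : Strategy1 Set.univ E S1 (fun _ t => f t) := fun _ t _ _ => ⟨hf t, trivial⟩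
    have h := key True (play S1 (fun _ t => f t) π s)
      (play_edge E S1 _ _ s hs1 hπ)
      (fun n hn => by rw [play_succ, if_pos (hn.mp trivial)]) (iff_true_intro hev)
    have h' : Odd _ := hwin _ hs1
    exact (Nat.not_even_iff_odd.mpr h') (h.mpr trivial)
  have hs2 : Strategy2 Set.univ E S1 (fun _ t => f t) := fun _ t _ _ => ⟨hf t, trivial⟩
  have h := key False (play S1 σ (fun _ t => f t) s)
    (play_edge E S1 _ _ s hσ hs2)
    (fun n hn => by rw [play_succ, if_neg (fun h => hn.mpr h)]) (iff_false_intro hodd)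
  exact Nat.not_even_iff_odd.mp (fun hh => h.mp hh)
end

section
/- Let G = ((S,E),(S₁,S₂)) be a game graph and p : S → {0,…,d−1} a priority function, and define G⁰ = G, A_i = Attr_{(i mod 2)+1}(p⁻¹(i) ∩ S^i, G^i), G^{i+1} = G^i restricted to S^{i+1} = S^i \ A_i as in the classical algorithm. Then for every even i with 0 ≤ i < d, A_i ⊆ W₁^G(WeakParityEven(p) ∩ {ω | min p(Occur(ω)) < i+1}), and for every odd i with 0 ≤ i < d, A_i ⊆ W₂^G(WeakParityOdd(p) ∩ {ω | min p(Occur(ω)) < i+1}). -/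
open scoped Classical

/-- The inductive attractor computation for player 1:
`R₀ = U` and `R_{i+1} = R_i ∪ {s ∈ S₁ ∣ E(s) ∩ R_i ≠ ∅} ∪ {s ∈ S₂ ∣ E(s) ⊆ R_i}`. -/
def Rseq {S : Type} (E : S → S → Prop) (S1 : Set S) (U : Set S) : ℕ → Set S
  | 0 => U
  | i + 1 =>
      Rseq E S1 U i ∪ {s | s ∈ S1 ∧ ∃ t ∈ Rseq E S1 U i, E s t} ∪
        {s | s ∉ S1 ∧ ∀ t, E s t → t ∈ Rseq E S1 U i}

/-- One step of the classical algorithm: the attractor, inside the sub-game with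
carrier `C`, for player `(i mod 2) + 1` to the set of states of priority `i` in `C`. -/
noncomputable def attrStep {S : Type} (E : S → S → Prop) (S1 : Set S) (p : S → ℕ)
    (C : Set S) (i : ℕ) : Set S :=
  if Even i then Attr1 C E S1 ((p ⁻¹' {i}) ∩ C)
  else Attr2 C E S1 ((p ⁻¹' {i}) ∩ C)

/-- The state space `Sⁱ` of the sub-game `Gⁱ` in the classical algorithm:
`S⁰ = S` and `S^{i+1} = Sⁱ \ Aᵢ`. -/
noncomputable def algoS {S : Type} (E : S → S → Prop) (S1 : Set S) (p : S → ℕ) :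
    ℕ → Set S
  | 0 => Set.univ
  | i + 1 => algoS E S1 p i \ attrStep E S1 p (algoS E S1 p i) i

/-- The attractor set `Aᵢ = Attr_{(i mod 2)+1}(p⁻¹(i) ∩ Sⁱ, Gⁱ)` of the classical
algorithm. -/
noncomputable def algoA {S : Type} (E : S → S → Prop) (S1 : Set S) (p : S → ℕ)
    (i : ℕ) : Set S :=
  attrStep E S1 p (algoS E S1 p i) i

theorem aux_congr {S : Type} {P : Set S} {σ π σ' π' : List S → S → S} {s : S}
    (h : ∀ n, ((playAux P σ π s n).2 ∈ P →
        σ' (playAux P σ π s n).1 (playAux P σ π s n).2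
          = σ (playAux P σ π s n).1 (playAux P σ π s n).2) ∧
      ((playAux P σ π s n).2 ∉ P →
        π' (playAux P σ π s n).1 (playAux P σ π s n).2
          = π (playAux P σ π s n).1 (playAux P σ π s n).2)) (n : ℕ) :
    playAux P σ' π' s n = playAux P σ π s n := by
  induction n with
  | zero => rfl
  | succ n ih =>
    simp only [playAux, ih]
    by_cases hP : (playAux P σ π s n).2 ∈ P
    · simp [hP, (h n).1 hP]
    · simp [hP, (h n).2 hP]

theorem aux_start {S : Type} (P : Set S) (σ π : List S → S → S) (s : S) (n : ℕ) :
    ∃ l, (playAux P σ π s n).1 ++ [(playAux P σ π s n).2] = s :: l := by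
  induction n with
  | zero => exact ⟨[], rfl⟩
  | succ n ih =>
    obtain ⟨l, hl⟩ := ih
    refine ⟨l ++ [(playAux P σ π s (n+1)).2], ?_⟩
    have : (playAux P σ π s (n+1)).1
        = (playAux P σ π s n).1 ++ [(playAux P σ π s n).2] := rfl
    rw [this, hl]; rfl

theorem aux_mem {S : Type} (P : Set S) (σ π : List S → S → S) (s : S) (n : ℕ) (y : S)
    (hy : y ∈ (playAux P σ π s n).1) : ∃ m < n, play P σ π s m = y := by
  induction n with
  | zero => simp [playAux] at hy
  | succ n ih =>
    simp only [playAux, List.mem_append, List.mem_singleton] at hy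
    rcases hy with hy | hy
    · obtain ⟨m, hm, e⟩ := ih hy
      exact ⟨m, by omega, e⟩
    · exact ⟨n, by omega, hy.symm⟩

theorem aux_shift {S : Type} (P : Set S) (σ π : List S → S → S) (s : S) (k n : ℕ) :
    playAux P σ π s (k + n) =
      ((playAux P σ π s k).1 ++
        (playAux P (fun w => σ ((playAux P σ π s k).1 ++ w))
          (fun w => π ((playAux P σ π s k).1 ++ w)) (playAux P σ π s k).2 n).1,
        (playAux P (fun w => σ ((playAux P σ π s k).1 ++ w))
          (fun w => π ((playAux P σ π s k).1 ++ w)) (playAux P σ π s k).2 n).2) := by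
  induction n with
  | zero => simp [playAux]
  | succ n ih =>
    rw [← Nat.add_assoc]
    simp only [playAux, ih, List.append_assoc]

theorem play_step {S : Type} (P : Set S) (σ π : List S → S → S) (s : S) (n : ℕ) :
    play P σ π s (n+1) = if play P σ π s n ∈ P
      then σ (playAux P σ π s n).1 (play P σ π s n)
      else π (playAux P σ π s n).1 (play P σ π s n) := rfl

theorem aux_swap {S : Type} (P : Set S) (σ π : List S → S → S) (s : S) (n : ℕ) :
    playAux Pᶜ π σ s n = playAux P σ π s n := by
  induction n with
  | zero => rfl
  | succ n ih =>
    simp only [playAux, ih]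
    by_cases hP : (playAux P σ π s n).2 ∈ P <;> simp [hP]

theorem play_swap {S : Type} (P : Set S) (σ π : List S → S → S) (s : S) :
    play Pᶜ π σ s = play P σ π s := by
  funext n; simp [play, aux_swap]

theorem W2_eq {S : Type} (C : Set S) (E : S → S → Prop) (P : Set S) (Φ : Set (ℕ → S)) :
    W2 C E P Φ = W1 C E Pᶜ Φ := by
  have h2 : ∀ σ, Strategy2 C E Pᶜ σ ↔ Strategy1 C E P σ := by
    intro σ; simp [Strategy1, Strategy2]
  have h1 : ∀ σ, Strategy1 C E Pᶜ σ ↔ Strategy2 C E P σ := by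
    intro σ; simp [Strategy1, Strategy2]
  ext s
  simp only [W1, W2, Set.mem_ofPred_eq, h1, h2, play_swap]

/-- Prepending one move. -/
theorem reach_closure {S : Type} {C : Set S} {E : S → S → Prop} {P U : Set S}
    (hC : ∀ s ∈ C, ∃ t ∈ C, E s t) {s : S} (hs : s ∈ C)
    (h1 : s ∈ P → ∃ t ∈ W1 C E P (Reach U), E s t)
    (h2 : s ∉ P → ∀ t ∈ C, E s t → t ∈ W1 C E P (Reach U)) :
    s ∈ W1 C E P (Reach U) := by
  have hsucc : ∀ x, ∃ t, x ∈ C → t ∈ C ∧ E x t := by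
    intro x
    by_cases hx : x ∈ C
    · obtain ⟨t, a, b⟩ := hC x hx; exact ⟨t, fun _ => ⟨a, b⟩⟩
    · exact ⟨x, fun h => absurd h hx⟩
  choose g hg using hsucc
  have hg1 : ∃ t, s ∈ P → t ∈ W1 C E P (Reach U) ∧ E s t := by
    by_cases hx : s ∈ P
    · obtain ⟨t, a, b⟩ := h1 hx; exact ⟨t, fun _ => ⟨a, b⟩⟩
    · exact ⟨s, fun h => absurd h hx⟩
  obtain ⟨t0, ht0⟩ := hg1
  have hτ : ∀ t, ∃ τ, Strategy1 C E P τ ∧ (t ∈ W1 C E P (Reach U) →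
      ∀ π, Strategy2 C E P π → play P τ π t ∈ Reach U) := by
    intro t
    by_cases ht : t ∈ W1 C E P (Reach U)
    · obtain ⟨_, τ, a, b⟩ := ht
      exact ⟨τ, a, fun _ => b⟩
    · exact ⟨fun _ x => g x, fun w x hx _ => ⟨(hg x hx).2, (hg x hx).1⟩, fun h => absurd h ht⟩
  choose τ hτ1 hτ2 using hτ
  refine ⟨hs, fun w x => match w with
    | [] => if x = s then t0 else g x
    | _ :: w' => τ ((w' ++ [x]).headD x) w' x, ?_, ?_⟩
  · intro w x hx hxP
    cases w with
    | nil =>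
      by_cases e : x = s
      · subst e
        simp only [if_true]
        exact ⟨(ht0 hxP).2, (ht0 hxP).1.1⟩
      · simp only [e, if_false]
        exact ⟨(hg x hx).2, (hg x hx).1⟩
    | cons a w' => exact hτ1 _ w' x hx hxP
  · intro π hπ
    set σ' : List S → S → S := fun w x => match w with
      | [] => if x = s then t0 else g x
      | _ :: w' => τ ((w' ++ [x]).headD x) w' x with hσ'
    set t := (playAux P σ' π s 1).2 with ht
    have htW : t ∈ W1 C E P (Reach U) := by
      by_cases hP : s ∈ P
      · have : t = t0 := by simp [ht, playAux, hP, hσ']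
        rw [this]; exact (ht0 hP).1
      · have : t = π [] s := by simp [ht, playAux, hP]
        rw [this]
        exact h2 hP _ (hπ [] s hs hP).2 (hπ [] s hs hP).1
    have hh : (playAux P σ' π s 1).1 = [s] := by simp [playAux]
    obtain ⟨k, hk⟩ := hτ2 t htW (fun w => π ([s] ++ w)) (fun w x hx hxP => hπ _ x hx hxP)
    refine ⟨1 + k, ?_⟩
    have := aux_shift P σ' π s 1 k
    rw [hh, ← ht] at this
    unfold play at hk ⊢
    rw [this]
    simp only
    rw [aux_congr (σ := τ t) (π := fun w => π ([s] ++ w))]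
    · exact hk
    · intro n
      refine ⟨fun _ => ?_, fun _ => rfl⟩
      obtain ⟨l, hl⟩ := aux_start P (τ t) (fun w => π ([s] ++ w)) t n
      simp only [hσ', List.singleton_append]
      simp only [List.singleton_append] at hl
      rw [hl]; rfl

theorem reach_base {S : Type} {C : Set S} {E : S → S → Prop} {P U : Set S}
    (hC : ∀ s ∈ C, ∃ t ∈ C, E s t) {s : S} (hs : s ∈ C) (hU : s ∈ U) :
    s ∈ W1 C E P (Reach U) := by
  have hsucc : ∀ x, ∃ t, x ∈ C → t ∈ C ∧ E x t := by
    intro x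
    by_cases hx : x ∈ C
    · obtain ⟨t, a, b⟩ := hC x hx; exact ⟨t, fun _ => ⟨a, b⟩⟩
    · exact ⟨x, fun h => absurd h hx⟩
  choose g hg using hsucc
  exact ⟨hs, fun _ x => g x, fun w x hx _ => ⟨(hg x hx).2, (hg x hx).1⟩, fun π _ => ⟨0, hU⟩⟩

theorem sub_diff {S : Type} {C : Set S} {E : S → S → Prop} {P U : Set S}
    (hC : ∀ s ∈ C, ∃ t ∈ C, E s t) :
    ∀ s ∈ C \ W1 C E P (Reach U), ∃ t ∈ C \ W1 C E P (Reach U), E s t := by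
  rintro s ⟨hs, hn⟩
  by_contra hcon
  have hall : ∀ t ∈ C, E s t → t ∈ W1 C E P (Reach U) := by
    intro t ht he
    by_contra h
    exact hcon ⟨t, ⟨ht, h⟩, he⟩
  apply hn
  refine reach_closure hC hs (fun _ => ?_) (fun _ => hall)
  obtain ⟨t, ht, he⟩ := hC s hs
  exact ⟨t, hall t ht he, he⟩

theorem combine {S : Type} {C D : Set S} {E : S → S → Prop} {P : Set S}
    {Φ Φ' : Set (ℕ → S)} (hE : ∀ s, ∃ t, E s t)
    (hC : ∀ s ∈ C, ∃ t ∈ C, E s t) {s : S} (hs : s ∈ W1 C E P Φ)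
    (hD : D ⊆ W1 Set.univ E P Φ')
    (hexit : ∀ x ∈ C, x ∉ P → ∀ t, E x t → t ∉ C → t ∈ D) :
    s ∈ W1 Set.univ E P {ω | (ω ∈ Φ ∧ ∀ n, ω n ∈ C) ∨
      ∃ k, (∀ m < k, ω m ∈ C) ∧ (fun n => ω (k + n)) ∈ Φ'} := by
  obtain ⟨hsC, σ, hσ, hwin⟩ := hs
  have hsucc : ∀ x, ∃ t, x ∈ C → t ∈ C ∧ E x t := by
    intro x
    by_cases hx : x ∈ C
    · obtain ⟨t, a, b⟩ := hC x hx; exact ⟨t, fun _ => ⟨a, b⟩⟩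
    · exact ⟨x, fun h => absurd h hx⟩
  choose g hg using hsucc
  choose e he using hE
  have hτ : ∀ t, ∃ τ, Strategy1 Set.univ E P τ ∧ (t ∈ D →
      ∀ π, Strategy2 Set.univ E P π → play P τ π t ∈ Φ') := by
    intro t
    by_cases ht : t ∈ D
    · obtain ⟨_, τ, a, b⟩ := hD ht
      exact ⟨τ, a, fun _ => b⟩
    · exact ⟨fun _ x => e x, fun w x hx _ => ⟨he x, trivial⟩, fun h => absurd h ht⟩
  choose τ hτ1 hτ2 using hτ
  set σ' : List S → S → S := fun w x =>
    if ∀ y ∈ w ++ [x], y ∈ C then σ w x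
    else τ ((w.dropWhile (fun y => decide (y ∈ C)) ++ [x]).headD x)
      (w.dropWhile (fun y => decide (y ∈ C))) x with hσ'
  refine ⟨trivial, σ', ?_, ?_⟩
  · intro w x _ hxP
    refine ⟨?_, trivial⟩
    simp only [hσ']
    split_ifs with h
    · exact (hσ w x (h x (by simp)) hxP).1
    · exact (hτ1 _ _ x trivial hxP).1
  · intro π hπ
    have hin : ∀ n, (∀ m ≤ n, play P σ' π s m ∈ C) →
        σ' (playAux P σ' π s n).1 (playAux P σ' π s n).2
          = σ (playAux P σ' π s n).1 (playAux P σ' π s n).2 := by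
      intro n hn
      simp only [hσ']
      rw [if_pos]
      intro y hy
      rw [List.mem_append, List.mem_singleton] at hy
      rcases hy with hy | hy
      · obtain ⟨m, hm, rfl⟩ := aux_mem P σ' π s n y hy
        exact hn m hm.le
      · rw [hy]; exact hn n le_rfl
    by_cases hall : ∀ n, play P σ' π s n ∈ C
    · left
      refine ⟨?_, hall⟩
      have key := hwin (fun w x => if E x (π w x) ∧ π w x ∈ C then π w x else g x) (by
        intro w x hx hxP
        dsimp only
        split_ifs with h
        · exact h
        · exact ⟨(hg x hx).2, (hg x hx).1⟩)
      convert key using 1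
      funext n
      unfold play
      refine congrArg Prod.snd (aux_congr (σ := σ') (π := π) ?_ n).symm
      intro n
      refine ⟨fun _ => (hin n (fun m _ => hall m)).symm, fun hP => ?_⟩
      rw [if_pos]
      refine ⟨(hπ _ _ trivial hP).1, ?_⟩
      have := hall (n+1)
      rw [play_step, if_neg (show play P σ' π s n ∉ P from hP)] at this
      exact this
    · right
      push Not at hall
      obtain ⟨k, hk, hmin⟩ : ∃ k, play P σ' π s k ∉ C ∧ ∀ m < k, play P σ' π s m ∈ C :=
        ⟨Nat.find hall, Nat.find_spec hall, fun m hm => not_not.1 (Nat.find_min hall hm)⟩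
      refine ⟨k, hmin, ?_⟩
      have htD : play P σ' π s k ∈ D := by
        cases k with
        | zero => exact absurd hsC hk
        | succ k =>
          have hkC := hmin k (by omega)
          rw [play_step] at hk ⊢
          split_ifs at hk ⊢ with hP
          · exfalso
            apply hk
            have := hin k (fun m hm => hmin m (by omega))
            unfold play
            rw [this]
            exact (hσ _ _ hkC hP).2
          · exact hexit _ hkC hP _ (hπ _ _ trivial hP).1 hk
      set t := play P σ' π s k with ht
      set h := (playAux P σ' π s k).1 with hh
      have key := hτ2 t htD (fun w => π (h ++ w)) (fun w x hx hxP => hπ _ x hx hxP)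
      convert key using 1
      funext n
      unfold play
      rw [aux_shift]
      dsimp only
      rw [← hh, show (playAux P σ' π s k).2 = t from rfl]
      rw [aux_congr (σ := τ t) (π := fun w => π (h ++ w))]
      intro n
      refine ⟨fun _ => ?_, fun _ => rfl⟩
      obtain ⟨l, hl⟩ := aux_start P (τ t) (fun w => π (h ++ w)) t n
      generalize (playAux P (τ t) (fun w => π (h ++ w)) t n).1 = w at hl ⊢
      generalize (playAux P (τ t) (fun w => π (h ++ w)) t n).2 = x at hl ⊢
      have hhC : ∀ y ∈ h, y ∈ C := by
        intro y hy
        obtain ⟨m, hm, rfl⟩ := aux_mem P σ' π s k y hy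
        exact hmin m hm
      have hdrop : (h ++ w).dropWhile (fun y => decide (y ∈ C)) = w := by
        rw [List.dropWhile_append_of_pos (by simpa using hhC)]
        cases w with
        | nil => rfl
        | cons a w' =>
          have : a = t := by simpa using congrArg List.head? hl
          rw [List.dropWhile_cons_of_neg]
          rw [this]; simpa using hk
      simp only [hσ']
      rw [if_neg, hdrop, hl]
      · rfl
      · intro hcon
        apply hk
        apply hcon
        rw [List.append_assoc, hl]; simp

/-- The player owning step `i`. -/
def own {S : Type} (S1 : Set S) (i : ℕ) : Set S := if Even i then S1 else S1ᶜ

theorem attrStep_eq {S : Type} (E : S → S → Prop) (S1 : Set S) (p : S → ℕ)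
    (C : Set S) (i : ℕ) :
    attrStep E S1 p C i = W1 C E (own S1 i) (Reach ((p ⁻¹' {i}) ∩ C)) := by
  unfold attrStep own Attr1 Attr2
  split_ifs
  · rfl
  · exact W2_eq _ _ _ _

theorem algoS_sub {S : Type} (E : S → S → Prop) (S1 : Set S) (p : S → ℕ)
    (hE : ∀ s, ∃ t, E s t) (i : ℕ) :
    ∀ s ∈ algoS E S1 p i, ∃ t ∈ algoS E S1 p i, E s t := by
  induction i with
  | zero => intro s _; obtain ⟨t, ht⟩ := hE s; exact ⟨t, trivial, ht⟩
  | succ i ih =>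
    simp only [algoS, attrStep_eq]
    exact sub_diff ih

theorem algoS_anti {S : Type} (E : S → S → Prop) (S1 : Set S) (p : S → ℕ)
    {i j : ℕ} (h : i ≤ j) : algoS E S1 p j ⊆ algoS E S1 p i := by
  induction j, h using Nat.le_induction with
  | base => exact subset_rfl
  | succ j _ ih => exact Set.sdiff_subset.trans ih

theorem algoS_prio {S : Type} (E : S → S → Prop) (S1 : Set S) (p : S → ℕ)
    (hE : ∀ s, ∃ t, E s t) (i : ℕ) : ∀ s ∈ algoS E S1 p i, i ≤ p s := by
  intro s hs
  by_contra hlt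
  push Not at hlt
  have h1 := algoS_anti E S1 p (Nat.succ_le_of_lt hlt) hs
  have h2 : s ∈ algoS E S1 p (p s) := h1.1
  apply h1.2
  rw [attrStep_eq]
  exact reach_base (algoS_sub E S1 p hE _) h2 ⟨rfl, h2⟩

theorem algoS_compl {S : Type} (E : S → S → Prop) (S1 : Set S) (p : S → ℕ)
    (i : ℕ) : ∀ s ∉ algoS E S1 p i, ∃ j < i, s ∈ algoA E S1 p j := by
  induction i with
  | zero => intro s hs; exact absurd trivial hs
  | succ i ih =>
    intro s hs
    by_cases h : s ∈ algoS E S1 p i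
    · exact ⟨i, by omega, by by_contra h2; exact hs ⟨h, h2⟩⟩
    · obtain ⟨j, hj, h2⟩ := ih s h
      exact ⟨j, by omega, h2⟩

theorem own_congr {S : Type} (S1 : Set S) {i j : ℕ} (h : i % 2 = j % 2) :
    own S1 i = own S1 j := by
  unfold own; simp only [Nat.even_iff, h]

theorem own_compl {S : Type} (S1 : Set S) {i j : ℕ} (h : i % 2 ≠ j % 2) :
    own S1 i = (own S1 j)ᶜ := by
  unfold own
  by_cases hi : Even i <;> by_cases hj : Even j <;> simp [hi, hj] <;>
    (simp only [Nat.even_iff] at hi hj; omega)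

theorem main_aux {S : Type} (E : S → S → Prop) (S1 : Set S) (p : S → ℕ)
    (hE : ∀ s, ∃ t, E s t) (i : ℕ) :
    algoA E S1 p i ⊆ W1 Set.univ E (own S1 i)
      {ω | sInf (p '' Set.range ω) % 2 = i % 2 ∧ sInf (p '' Set.range ω) < i + 1} := by
  induction i using Nat.strong_induction_on with
  | _ i IH =>
  intro s hs
  have hs' := hs
  unfold algoA at hs'
  rw [attrStep_eq] at hs'
  have hcomb := combine (D := {t | ∃ j < i, j % 2 = i % 2 ∧ t ∈ algoA E S1 p j})
    (Φ' := {ω | sInf (p '' Set.range ω) % 2 = i % 2 ∧ sInf (p '' Set.range ω) < i})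
    hE (algoS_sub E S1 p hE i) hs' (by
      rintro t ⟨j, hj, hpar, ht⟩
      obtain ⟨_, σ, a, b⟩ := IH j hj ht
      rw [own_congr S1 hpar] at a b
      refine ⟨trivial, σ, a, fun π hπ => ?_⟩
      obtain ⟨c, d⟩ := b π hπ
      exact ⟨c.trans hpar, by omega⟩) (by
      intro x hx hxP t hxt ht
      obtain ⟨j, hj, htA⟩ := algoS_compl E S1 p i t ht
      refine ⟨j, hj, ?_, htA⟩
      by_contra hpar
      have h1 := algoS_anti E S1 p (Nat.succ_le_of_lt hj) hx
      apply h1.2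
      unfold algoA at htA
      rw [attrStep_eq] at htA ⊢
      refine reach_closure (algoS_sub E S1 p hE j) h1.1 (fun _ => ⟨t, htA, hxt⟩) ?_
      intro hn
      rw [own_compl S1 hpar] at hn
      exact absurd hxP hn)
  obtain ⟨_, σ, a, b⟩ := hcomb
  refine ⟨trivial, σ, a, fun π hπ => ?_⟩
  have hb := b π hπ
  generalize play (own S1 i) σ π s = ω at hb
  rcases hb with ⟨⟨k, hk⟩, hC⟩ | ⟨k, hpre, hpar, hlt⟩
  · have : sInf (p '' Set.range ω) = i := by
      apply le_antisymm
      · exact Nat.sInf_le ⟨ω k, ⟨k, rfl⟩, hk.1⟩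
      · apply le_csInf ((Set.range_nonempty ω).image p)
        rintro _ ⟨_, ⟨n, rfl⟩, rfl⟩
        exact algoS_prio E S1 p hE i _ (hC n)
    simp [this]
  · have : sInf (p '' Set.range ω) = sInf (p '' Set.range (fun n => ω (k + n))) := by
      apply le_antisymm
      · obtain ⟨_, ⟨n, rfl⟩, hn⟩ :=
          Nat.sInf_mem ((Set.range_nonempty (fun n => ω (k + n))).image p)
        rw [← hn]
        exact Nat.sInf_le ⟨_, ⟨k + n, rfl⟩, rfl⟩
      · apply le_csInf ((Set.range_nonempty ω).image p)
        rintro _ ⟨_, ⟨n, rfl⟩, rfl⟩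
        by_cases hn : n < k
        · exact hlt.le.trans (algoS_prio E S1 p hE i _ (hpre n hn))
        · refine Nat.sInf_le ⟨_, ⟨n - k, rfl⟩, ?_⟩
          dsimp only
          congr 2; omega
    simp only [Set.mem_ofPred_eq]
    rw [this]
    exact ⟨hpar, by omega⟩

/-- For every even `i < d`,
`Aᵢ ⊆ W₁ᴳ(WeakParityEven(p) ∩ {ω ∣ min p(Occur(ω)) < i+1})`, and for every odd
`i < d`, `Aᵢ ⊆ W₂ᴳ(WeakParityOdd(p) ∩ {ω ∣ min p(Occur(ω)) < i+1})`. -/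
theorem algo_attractor_winning {S : Type} [Fintype S]
    (E : S → S → Prop) (S1 : Set S) (hE : ∀ s, ∃ t, E s t)
    (d : ℕ) (p : S → ℕ) (hp : ∀ s, p s < d) :
    (∀ i, i < d → Even i →
      algoA E S1 p i ⊆
        W1 Set.univ E S1
          (WeakParityEven p ∩ {ω | sInf (p '' Set.range ω) < i + 1})) ∧
    (∀ i, i < d → Odd i →
      algoA E S1 p i ⊆
        W2 Set.univ E S1
          (WeakParityOdd p ∩ {ω | sInf (p '' Set.range ω) < i + 1})) := by
  constructor
  · intro i _ hi s hs
    have h := main_aux E S1 p hE i hs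
    rw [show own S1 i = S1 from if_pos hi] at h
    obtain ⟨h1, σ, a, b⟩ := h
    refine ⟨h1, σ, a, fun π hπ => ⟨?_, (b π hπ).2⟩⟩
    have := (b π hπ).1
    simp only [WeakParityEven, Set.mem_setOf_eq]
    rw [Nat.even_iff] at hi ⊢
    omega
  · intro i _ hi s hs
    have h := main_aux E S1 p hE i hs
    rw [show own S1 i = S1ᶜ from if_neg (Nat.not_even_iff_odd.2 hi), ← W2_eq] at h
    obtain ⟨h1, σ, a, b⟩ := h
    refine ⟨h1, σ, a, fun π hπ => ⟨?_, (b π hπ).2⟩⟩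
    have := (b π hπ).1
    simp only [WeakParityOdd, Set.mem_setOf_eq]
    rw [Nat.odd_iff] at hi ⊢
    omega
end
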